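/- If x ≠ y, then for every integer N > 0 there exists n > N with fₙ(x) ≠ fₙ(y). -/

import Mathlib

open Filter Topology
open scoped Classical

noncomputable def delegate {X : Type*} [MetricSpace X] (r : ℕ → X) : ℕ → X → X
  | 0, _ => r 0
  | n+1, x => if dist x (delegate r n x) ≤ dist x (r (n+1)) then delegate r n x else r (n+1)

noncomputable def score {X : Type*} [MetricSpace X] (r : ℕ → X) (a : ℕ → ℝ) (x y : X) : ℝ :=
  ∑' i, if delegate r i x ≠ delegate r i y then a i else 0

theorem dist_delegate_le {X : Type*} [MetricSpace X] (r : ℕ → X) (x : X) {m n : ℕ} (h : m ≤ n) :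
    dist x (delegate r n x) ≤ dist x (r m) := by
  induction n with
  | zero =>
    obtain rfl : m = 0 := by omega
    simp [delegate]
  | succ n ih =>
    rw [delegate]
    rcases Nat.le_succ_iff.mp h with hm | rfl
    · have := ih hm
      split_ifs with hc <;> linarith
    · split_ifs with hc
      · exact hc
      · exact le_rfl

theorem stmt4 {X : Type*} [MetricSpace X] (r : ℕ → X) (hr : Function.Injective r)
    (hd : DenseRange r) (x y : X) (hxy : x ≠ y) (N : ℕ) :
    ∃ n > N, delegate r n x ≠ delegate r n y := by
  have hpos : 0 < dist x y / 2 := half_pos (dist_pos.mpr hxy)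
  obtain ⟨i, hi⟩ := hd.exists_dist_lt x hpos
  obtain ⟨j, hj⟩ := hd.exists_dist_lt y hpos
  refine ⟨N + 1 + i + j, by omega, fun h => ?_⟩
  have hx := dist_delegate_le r x (show i ≤ N + 1 + i + j by omega)
  have hy := dist_delegate_le r y (show j ≤ N + 1 + i + j by omega)
  rw [h] at hx
  have := dist_triangle_right x y (delegate r (N + 1 + i + j) y)
  linarith
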